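/- arXiv:2605.14195 — 12 statements merged into one kernel-verified Lean document; each statement's English description precedes it below -/
import Mathlib

section
/- For every natural number n ≥ 1 and every real number Λ with 0 ≤ Λ ≤ 1, we have 1 - (1 - Λ/n)^n ≥ (1 - (1 - 1/n)^n) · Λ, and moreover 1 - (1 - 1/n)^n ≥ 1 - 1/e, so that 1 - (1 - Λ/n)^n ≥ (1 - 1/e) · Λ. -/
theorem stmt_0 (n : ℕ) (hn : 1 ≤ n) (Λ : ℝ) (hΛ0 : 0 ≤ Λ) (hΛ1 : Λ ≤ 1) :
    1 - (1 - Λ / n) ^ n ≥ (1 - (1 - 1 / (n : ℝ)) ^ n) * Λ ∧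
    1 - (1 - 1 / (n : ℝ)) ^ n ≥ 1 - 1 / Real.exp 1 ∧
    1 - (1 - Λ / n) ^ n ≥ (1 - 1 / Real.exp 1) * Λ := by
  have hn' : (1 : ℝ) ≤ n := by exact_mod_cast hn
  have hbase : (0 : ℝ) ≤ 1 - 1 / n := by
    rw [sub_nonneg, div_le_one (by linarith)]
    exact hn'
  have hchord : 1 - (1 - Λ / n) ^ n ≥ (1 - (1 - 1 / (n : ℝ)) ^ n) * Λ := by
    have h := (convexOn_pow (𝕜 := ℝ) n).2 (Set.mem_Ici.2 zero_le_one) (Set.mem_Ici.2 hbase)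
      (sub_nonneg.2 hΛ1) hΛ0 (sub_add_cancel 1 Λ)
    simp only [smul_eq_mul, one_pow] at h
    rw [show (1 - Λ) * 1 + Λ * (1 - 1 / (n : ℝ)) = 1 - Λ / n by ring] at h
    linarith
  have hexp : 1 - (1 - 1 / (n : ℝ)) ^ n ≥ 1 - 1 / Real.exp 1 := by
    have h := Real.one_sub_div_pow_le_exp_neg hn'
    rw [Real.exp_neg, ← one_div] at h
    linarith
  exact ⟨hchord, hexp, (mul_le_mul_of_nonneg_right hexp hΛ0).trans hchord⟩
end

section
/- Let E be a nonempty finite index set, let x : E → ℝ with x_e ≥ 0 for all e, let X = ∑_{e ∈ E} x_e > 0, let k be a natural number, and let τ > 0 be a real number satisfying ∑_{e ∈ E} min(1, τ·x_e) = min(k, |E|). Then for every e ∈ E, the inclusion probability π_e := min(1, τ·x_e) satisfies π_e ≥ min(1, k·x_e / X). -/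
theorem stmt_1 {ι : Type*} [DecidableEq ι] (E : Finset ι) (hE : E.Nonempty)
    (x : ι → ℝ) (hx : ∀ e ∈ E, 0 ≤ x e)
    (X : ℝ) (hX : X = ∑ e ∈ E, x e) (hXpos : 0 < X)
    (k : ℕ) (τ : ℝ) (hτ : 0 < τ)
    (hsum : ∑ e ∈ E, min 1 (τ * x e) = min (k : ℝ) (E.card : ℝ)) :
    ∀ e ∈ E, min 1 (τ * x e) ≥ min 1 ((k : ℝ) * x e / X) := by
  intro e he
  rcases le_total (k : ℝ) (E.card : ℝ) with hk | hk
  · have hkX : (k : ℝ) ≤ τ * X := by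
      rw [← min_eq_left hk, ← hsum, hX, Finset.mul_sum]
      exact Finset.sum_le_sum fun i _ => min_le_right _ _
    refine min_le_min_left 1 ?_
    rw [div_le_iff₀ hXpos]
    nlinarith [mul_le_mul_of_nonneg_right hkX (hx e he)]
  · have hone : ∑ i ∈ E, min 1 (τ * x i) = ∑ _i ∈ E, (1 : ℝ) := by
      rw [hsum, min_eq_right hk]
      simp
    rw [(Finset.sum_eq_sum_iff_of_le fun i _ => min_le_left _ _).1 hone e he]
    exact min_le_left _ _
end

section
/- Let E be a finite index set, let x : E → ℝ with x_e > 0 for all e, let k be a natural number, and let τ > 0 satisfy ∑_{e ∈ E} min(1, τ·x_e) = k. Let H = {e ∈ E : τ·x_e ≥ 1} be the set of heavy items, and let S be any subset of E with H ⊆ S and |S| = k. Then the inverse-probability weights sum is deterministically preserved: ∑_{e ∈ S} x_e / min(1, τ·x_e) = ∑_{e ∈ E} x_e. -/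
theorem div_min_one_mul_eq_add {τ a : ℝ} (hτ : 0 < τ) (ha : 0 < a) :
    a / min 1 (τ * a) = a + (1 - min 1 (τ * a)) / τ := by
  rcases le_total 1 (τ * a) with h | h
  · simp [min_eq_left h]
  · rw [min_eq_right h]
    field_simp
    ring

theorem stmt_2 {ι : Type*} [DecidableEq ι] (E : Finset ι)
    (x : ι → ℝ) (hx : ∀ e ∈ E, 0 < x e)
    (k : ℕ) (τ : ℝ) (hτ : 0 < τ)
    (hsum : ∑ e ∈ E, min 1 (τ * x e) = (k : ℝ))
    (H : Finset ι) (hH : H = E.filter fun e => 1 ≤ τ * x e)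
    (S : Finset ι) (hSE : S ⊆ E) (hHS : H ⊆ S) (hScard : S.card = k) :
    ∑ e ∈ S, x e / min 1 (τ * x e) = ∑ e ∈ E, x e := by
  have hlight : ∑ e ∈ E \ S, min 1 (τ * x e) = τ * ∑ e ∈ E \ S, x e := by
    rw [Finset.mul_sum]
    refine Finset.sum_congr rfl fun e he => min_eq_right ?_
    obtain ⟨heE, heS⟩ := Finset.mem_sdiff.mp he
    by_contra! h
    exact heS (hHS (by simp [hH, heE, h.le]))
  rw [← Finset.sum_sdiff hSE, hlight] at hsum
  rw [Finset.sum_congr rfl fun e he => div_min_one_mul_eq_add hτ (hx e (hSE he)),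
    Finset.sum_add_distrib, ← Finset.sum_div, Finset.sum_sub_distrib, Finset.sum_const,
    nsmul_one, hScard, ← Finset.sum_sdiff hSE, ← hsum, add_sub_cancel_right,
    mul_div_cancel_left₀ _ hτ.ne', add_comm]
end

section
/- Let E be a nonempty finite index set, let x : E → ℝ with x_e > 0 for all e ∈ E, and let k be a natural number with 1 ≤ k ≤ |E|. Then there exists a real number τ > 0 such that ∑_{e ∈ E} min(1, τ·x_e) = k. -/
theorem stmt_3 {ι : Type*} (E : Finset ι) (hE : E.Nonempty)
    (x : ι → ℝ) (hx : ∀ e ∈ E, 0 < x e)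
    (k : ℕ) (hk1 : 1 ≤ k) (hkE : k ≤ E.card) :
    ∃ τ : ℝ, 0 < τ ∧ ∑ e ∈ E, min 1 (τ * x e) = (k : ℝ) := by
  have hinv : ∀ e ∈ E, 0 ≤ (x e)⁻¹ := fun e he => (inv_pos.2 (hx e he)).le
  set T : ℝ := ∑ e ∈ E, (x e)⁻¹
  have hT : 0 ≤ T := Finset.sum_nonneg hinv
  have hcont : Continuous fun τ : ℝ => ∑ e ∈ E, min 1 (τ * x e) := by fun_prop
  have hzero : ∑ e ∈ E, min 1 ((0 : ℝ) * x e) = 0 := by simp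
  have htop : ∑ e ∈ E, min 1 (T * x e) = (E.card : ℝ) := by
    have hsat : ∀ e ∈ E, min 1 (T * x e) = 1 := fun e he =>
      min_eq_left ((inv_le_iff_one_le_mul₀ (hx e he)).1 (Finset.single_le_sum hinv he))
    simp [Finset.sum_congr rfl hsat]
  have hk : (k : ℝ) ∈ Set.Icc (∑ e ∈ E, min 1 ((0 : ℝ) * x e)) (∑ e ∈ E, min 1 (T * x e)) := by
    rw [hzero, htop]
    exact ⟨k.cast_nonneg, by exact_mod_cast hkE⟩
  obtain ⟨τ, hτ, hsum⟩ := intermediate_value_Icc hT hcont.continuousOn hk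
  refine ⟨τ, hτ.1.lt_of_ne ?_, hsum⟩
  rintro rfl
  have : (k : ℝ) = 0 := hsum.symm.trans hzero
  norm_cast at this
  omega
end

section
/- Let φ : ℕ → ℝ satisfy a linear growth bound |φ(n)| ≤ C·(1 + n) for some constant C ≥ 0 and all n. Define F(a) = ∑_{n=0}^{∞} (exp(−a)·aⁿ/n!)·φ(n) for a ≥ 0. Then for every a > 0, F is differentiable at a with derivative F′(a) = ∑_{n=0}^{∞} (exp(−a)·aⁿ/n!)·(φ(n+1) − φ(n)). -/
theorem summable_pow_div_factorial_mul {φ : ℕ → ℝ} {C r : ℝ} (hφ : ∀ n, |φ n| ≤ C * r ^ n)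
    (x : ℝ) : Summable fun n : ℕ => x ^ n / (n.factorial : ℝ) * φ n := by
  refine Summable.of_norm_bounded ((Real.summable_pow_div_factorial (|x| * r)).mul_left C)
    fun n => ?_
  rw [Real.norm_eq_abs, abs_mul, abs_div, abs_pow, Nat.abs_cast]
  calc |x| ^ n / (n.factorial : ℝ) * |φ n| ≤ |x| ^ n / (n.factorial : ℝ) * (C * r ^ n) := by
        gcongr
        exact hφ n
    _ = C * ((|x| * r) ^ n / (n.factorial : ℝ)) := by
        rw [mul_pow]
        ring

theorem hasDerivAt_tsum_pow_div_factorial_mul {φ : ℕ → ℝ} {C r : ℝ}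
    (hφ : ∀ n, |φ n| ≤ C * r ^ n) (a : ℝ) :
    HasDerivAt (fun x : ℝ => ∑' n : ℕ, x ^ n / (n.factorial : ℝ) * φ n)
      (∑' n : ℕ, a ^ n / (n.factorial : ℝ) * φ (n + 1)) a := by
  have hsum := summable_pow_div_factorial_mul hφ
  have hsplit : (fun x : ℝ => ∑' n : ℕ, x ^ n / (n.factorial : ℝ) * φ n) = fun x =>
      φ 0 + ∑' n : ℕ, x ^ (n + 1) / ((n + 1).factorial : ℝ) * φ (n + 1) := by
    funext x
    rw [(hsum x).tsum_eq_zero_add]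
    simp
  rw [hsplit]
  refine HasDerivAt.const_add _ ?_
  have hmem : a ∈ Metric.ball (0 : ℝ) (|a| + 1) := by simp
  have hbound : Summable fun n : ℕ =>
      (|a| + 1) ^ n / (n.factorial : ℝ) * (C * r ^ (n + 1)) := by
    refine ((Real.summable_pow_div_factorial ((|a| + 1) * r)).mul_left (C * r)).congr fun n => ?_
    rw [mul_pow, pow_succ]
    ring
  have htail : Summable fun n : ℕ => a ^ (n + 1) / ((n + 1).factorial : ℝ) * φ (n + 1) :=
    (summable_nat_add_iff (f := fun n : ℕ => a ^ n / (n.factorial : ℝ) * φ n) 1).2 (hsum a)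
  refine hasDerivAt_tsum_of_isPreconnected
    (g := fun n x => x ^ (n + 1) / ((n + 1).factorial : ℝ) * φ (n + 1))
    (g' := fun n x => x ^ n / (n.factorial : ℝ) * φ (n + 1)) hbound Metric.isOpen_ball
    (convex_ball (0 : ℝ) (|a| + 1)).isPreconnected (fun n y _ => ?_) (fun n y hy => ?_)
    hmem htail hmem
  · refine (((hasDerivAt_pow (n + 1) y).div_const ((n + 1).factorial : ℝ)).mul_const
      (φ (n + 1))).congr_deriv ?_
    rw [Nat.factorial_succ]
    push_cast
    field_simp
  · rw [Real.norm_eq_abs, abs_mul, abs_div, abs_pow, Nat.abs_cast]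
    have hy' : |y| ≤ |a| + 1 := by simpa using (mem_ball_zero_iff.1 hy).le
    gcongr
    exact hφ (n + 1)

theorem stmt_4 (φ : ℕ → ℝ) (C : ℝ) (hC : 0 ≤ C)
    (hφ : ∀ n : ℕ, |φ n| ≤ C * (1 + (n : ℝ)))
    (F : ℝ → ℝ)
    (hF : ∀ a : ℝ, F a = ∑' n : ℕ, (Real.exp (-a) * a ^ n / (n.factorial : ℝ)) * φ n) :
    ∀ a : ℝ, 0 < a →
      HasDerivAt F (∑' n : ℕ, (Real.exp (-a) * a ^ n / (n.factorial : ℝ)) * (φ (n + 1) - φ n)) a := by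
  intro a _
  have hpow : ∀ n, |φ n| ≤ C * 2 ^ n := fun n => (hφ n).trans <| by
    gcongr
    exact_mod_cast (Nat.add_comm 1 n).trans_le Nat.lt_two_pow_self
  have hpow_succ : ∀ n, |φ (n + 1)| ≤ C * 2 * 2 ^ n := fun n =>
    (hpow (n + 1)).trans_eq (by ring)
  have hF' : F = fun x => Real.exp (-x) * ∑' n : ℕ, x ^ n / (n.factorial : ℝ) * φ n := by
    funext x
    rw [hF, ← tsum_mul_left]
    exact tsum_congr fun n => by ring
  have hderiv : ∑' n : ℕ, (Real.exp (-a) * a ^ n / (n.factorial : ℝ)) * (φ (n + 1) - φ n) =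
      Real.exp (-a) * -1 * (∑' n : ℕ, a ^ n / (n.factorial : ℝ) * φ n) +
        Real.exp (-a) * ∑' n : ℕ, a ^ n / (n.factorial : ℝ) * φ (n + 1) := by
    rw [mul_neg_one, neg_mul, neg_add_eq_sub, ← mul_sub,
      ← (summable_pow_div_factorial_mul hpow_succ a).tsum_sub
        (summable_pow_div_factorial_mul hpow a), ← tsum_mul_left]
    exact tsum_congr fun n => by ring
  rw [hF', hderiv]
  exact (hasDerivAt_neg a).exp.mul (hasDerivAt_tsum_pow_div_factorial_mul hpow a)
end

section
/- Let φ : ℕ → ℝ satisfy a linear growth bound |φ(n)| ≤ C·(1 + n) for some constant C ≥ 0 and all n, and suppose φ is discretely convex, i.e. φ(n+2) − 2·φ(n+1) + φ(n) ≥ 0 for all n ∈ ℕ. Then the function F : [0, ∞) → ℝ defined by F(a) = ∑_{n=0}^{∞} (exp(−a)·aⁿ/n!)·φ(n) is convex on [0, ∞). -/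
/-- The exponential generating series of a geometrically bounded sequence converges. -/
theorem summable_pow_div_factorial_mul_of_le_geometric {φ : ℕ → ℝ} {C r : ℝ}
    (hφ : ∀ n, |φ n| ≤ C * r ^ n) (a : ℝ) :
    Summable fun n : ℕ => a ^ n / (n.factorial : ℝ) * φ n := by
  refine Summable.of_norm_bounded
    ((Real.summable_pow_div_factorial (|a| * r)).mul_left C) fun n => ?_
  rw [Real.norm_eq_abs, abs_mul, abs_div, abs_pow, Nat.abs_cast]
  calc |a| ^ n / (n.factorial : ℝ) * |φ n|
      ≤ |a| ^ n / (n.factorial : ℝ) * (C * r ^ n) := by gcongr; exact hφ n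
    _ = C * ((|a| * r) ^ n / (n.factorial : ℝ)) := by rw [mul_pow]; ring

/-- The Poisson expectation of `φ`, as a function of the rate. -/
noncomputable def poissonExpectation (φ : ℕ → ℝ) (a : ℝ) : ℝ :=
  ∑' n : ℕ, Real.exp (-a) * a ^ n / (n.factorial : ℝ) * φ n

theorem poissonExpectation_eq_exp_mul (φ : ℕ → ℝ) (a : ℝ) :
    poissonExpectation φ a = Real.exp (-a) * ∑' n : ℕ, a ^ n / (n.factorial : ℝ) * φ n := by
  rw [poissonExpectation, ← tsum_mul_left]
  simp only [mul_div_assoc, mul_assoc]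

theorem poissonExpectation_nonneg {φ : ℕ → ℝ} (hφ : ∀ n, 0 ≤ φ n) {a : ℝ} (ha : 0 ≤ a) :
    0 ≤ poissonExpectation φ a :=
  tsum_nonneg fun n => mul_nonneg (by positivity) (hφ n)

theorem abs_succ_le_geometric {φ : ℕ → ℝ} {C r : ℝ} (hφ : ∀ n, |φ n| ≤ C * r ^ n) (n : ℕ) :
    |φ (n + 1)| ≤ C * r * r ^ n :=
  (hφ (n + 1)).trans_eq (by ring)

/-- The derivative of a Poisson expectation in the rate is the expectation of the forward
difference. -/
theorem hasDerivAt_poissonExpectation {φ : ℕ → ℝ} {C r : ℝ}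
    (hφ : ∀ n, |φ n| ≤ C * r ^ n) (a : ℝ) :
    HasDerivAt (poissonExpectation φ) (poissonExpectation (fun n => φ (n + 1) - φ n) a) a := by
  rw [funext (poissonExpectation_eq_exp_mul φ), poissonExpectation_eq_exp_mul]
  have h := (hasDerivAt_neg a).exp.mul (hasDerivAt_tsum_pow_div_factorial_mul hφ a)
  convert! h using 1
  simp only [mul_sub]
  rw [(summable_pow_div_factorial_mul_of_le_geometric (abs_succ_le_geometric hφ) a).tsum_sub
    (summable_pow_div_factorial_mul_of_le_geometric hφ a)]
  ring

theorem stmt_5 (φ : ℕ → ℝ) (C : ℝ) (hC : 0 ≤ C)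
    (hφ : ∀ n : ℕ, |φ n| ≤ C * (1 + (n : ℝ)))
    (hconv : ∀ n : ℕ, 0 ≤ φ (n + 2) - 2 * φ (n + 1) + φ n)
    (F : ℝ → ℝ)
    (hF : ∀ a : ℝ, F a = ∑' n : ℕ, (Real.exp (-a) * a ^ n / (n.factorial : ℝ)) * φ n) :
    ConvexOn ℝ (Set.Ici (0 : ℝ)) F := by
  obtain rfl : F = poissonExpectation φ := funext hF
  have hgeom (n : ℕ) : |φ n| ≤ C * 2 ^ n := by
    refine (hφ n).trans (mul_le_mul_of_nonneg_left ?_ hC)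
    have := one_add_mul_le_pow (show (-2 : ℝ) ≤ 1 by norm_num) n
    norm_num at this
    linarith
  have hdiff (n : ℕ) : |φ (n + 1) - φ n| ≤ (C * 2 + C) * 2 ^ n := by
    rw [add_mul]
    exact (abs_sub _ _).trans (add_le_add (abs_succ_le_geometric hgeom n) (hgeom n))
  refine convexOn_of_hasDerivWithinAt2_nonneg (convex_Ici 0)
    (fun a _ => (hasDerivAt_poissonExpectation hgeom a).continuousAt.continuousWithinAt)
    (fun a _ => (hasDerivAt_poissonExpectation hgeom a).hasDerivWithinAt)
    (fun a _ => (hasDerivAt_poissonExpectation hdiff a).hasDerivWithinAt)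
    fun a ha => poissonExpectation_nonneg (fun n => ?_) (interior_subset ha)
  linarith [hconv n]
end

section
/- Fix real numbers s, s′ with 0 < s < s′ ≤ 1 and a rate a > 0. Then for every convex function φ : ℝ → ℝ satisfying a linear growth bound |φ(x)| ≤ C·(1 + x) for all x ≥ 0 and some constant C ≥ 0, we have ∑_{n=0}^{∞} (exp(−a)·aⁿ/n!)·φ(s·n) ≤ ∑_{n=0}^{∞} (exp(−a·s/s′)·(a·s/s′)ⁿ/n!)·φ(s′·n). In particular, the two sums have the same value when φ is the identity (both equal a·s), and taking φ(x) = max(x − 1, 0) shows the expected excess can only increase. -/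
/-- A linearly bounded function has an absolutely convergent Poisson expectation. -/
theorem summable_norm_pow_div_factorial_mul_of_linear_bound {φ : ℝ → ℝ} {C : ℝ} (hC : 0 ≤ C)
    (hφ : ∀ x : ℝ, 0 ≤ x → |φ x| ≤ C * (1 + x)) {c r : ℝ} (hc : 0 ≤ c) (hr : 0 ≤ r) :
    Summable fun n : ℕ => ‖r ^ n / (n.factorial : ℝ) * φ (c * n)‖ := by
  refine Summable.of_nonneg_of_le (fun n => norm_nonneg _) (fun n => ?_)
    ((Real.summable_pow_div_factorial (2 * r)).mul_left (C * (1 + c)))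
  have h0 : 0 ≤ r ^ n / (n.factorial : ℝ) := by positivity
  have h1 : (1 : ℝ) ≤ 2 ^ n := one_le_pow₀ (by norm_num)
  have h2 : (n : ℝ) ≤ 2 ^ n := by exact_mod_cast n.lt_two_pow_self.le
  have h3 : 1 + c * n ≤ (1 + c) * 2 ^ n := by
    linarith [mul_le_mul_of_nonneg_left h2 hc]
  calc ‖r ^ n / (n.factorial : ℝ) * φ (c * n)‖
      = r ^ n / (n.factorial : ℝ) * |φ (c * n)| := by
        rw [norm_mul, Real.norm_of_nonneg h0, Real.norm_eq_abs]
    _ ≤ r ^ n / (n.factorial : ℝ) * (C * ((1 + c) * 2 ^ n)) := by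
        gcongr
        exact (hφ _ (by positivity)).trans (by gcongr)
    _ = C * (1 + c) * ((2 * r) ^ n / (n.factorial : ℝ)) := by rw [mul_pow]; ring

/-- Jensen's inequality for the binomial distribution. -/
theorem ConvexOn.map_mul_natCast_le_sum_binomial {φ : ℝ → ℝ} (hφ : ConvexOn ℝ Set.univ φ)
    {p : ℝ} (hp0 : 0 ≤ p) (hp1 : p ≤ 1) (c : ℝ) (n : ℕ) :
    φ (c * p * n) ≤
      ∑ k ∈ Finset.range (n + 1), (n.choose k : ℝ) * p ^ k * (1 - p) ^ (n - k) * φ (c * k) := by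
  have hsum := congrArg (Polynomial.eval p) (bernsteinPolynomial.sum ℝ n)
  have hmean := congrArg (Polynomial.eval p) (bernsteinPolynomial.sum_smul ℝ n)
  simp only [bernsteinPolynomial, Polynomial.eval_finsetSum, Polynomial.eval_mul,
    Polynomial.eval_pow, Polynomial.eval_sub, Polynomial.eval_one, Polynomial.eval_X,
    Polynomial.eval_natCast, nsmul_eq_mul] at hsum hmean
  have hq : 0 ≤ 1 - p := sub_nonneg.2 hp1
  have h := hφ.map_sum_le (t := Finset.range (n + 1))
    (w := fun k => (n.choose k : ℝ) * p ^ k * (1 - p) ^ (n - k)) (p := fun k : ℕ => c * (k : ℝ))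
    (fun k _ => by positivity) hsum (fun _ _ => Set.mem_univ _)
  simp only [smul_eq_mul] at h
  refine (congrArg φ ?_).trans_le h
  rw [mul_assoc, mul_comm p, ← hmean, Finset.mul_sum]
  exact Finset.sum_congr rfl fun k _ => by ring

/-- Independent thinning of a Poisson variable increases it in the convex order, once rescaled to
keep the mean. -/
theorem ConvexOn.tsum_poisson_le_tsum_poisson_thinning {φ : ℝ → ℝ} (hφ : ConvexOn ℝ Set.univ φ)
    {C : ℝ} (hC : 0 ≤ C) (hbound : ∀ x : ℝ, 0 ≤ x → |φ x| ≤ C * (1 + x))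
    {a c p : ℝ} (ha : 0 ≤ a) (hc : 0 ≤ c) (hp0 : 0 ≤ p) (hp1 : p ≤ 1) :
    ∑' n : ℕ, (Real.exp (-a) * a ^ n / (n.factorial : ℝ)) * φ (c * p * n) ≤
      ∑' n : ℕ, (Real.exp (-(a * p)) * (a * p) ^ n / (n.factorial : ℝ)) * φ (c * n) := by
  have hq : 0 ≤ 1 - p := sub_nonneg.2 hp1
  have hf := summable_norm_pow_div_factorial_mul_of_linear_bound hC hbound hc (mul_nonneg ha hp0)
  have hg : Summable fun n : ℕ => ‖(a * (1 - p)) ^ n / (n.factorial : ℝ)‖ :=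
    (Real.summable_pow_div_factorial _).norm
  have hexp : ∑' n : ℕ, (a * (1 - p)) ^ n / (n.factorial : ℝ) = Real.exp (a * (1 - p)) := by
    rw [Real.exp_eq_exp_ℝ, NormedSpace.exp_eq_tsum_div]
  have hprod := tsum_mul_tsum_eq_tsum_sum_range_of_summable_norm hf hg
  have hsummable := (summable_norm_sum_mul_range_of_summable_norm hf hg).of_norm
  have hleft := (summable_norm_pow_div_factorial_mul_of_linear_bound hC hbound
    (mul_nonneg hc hp0) ha).of_norm
  have hle : ∑' n : ℕ, a ^ n / (n.factorial : ℝ) * φ (c * p * n) ≤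
      (∑' n : ℕ, (a * p) ^ n / (n.factorial : ℝ) * φ (c * n)) * Real.exp (a * (1 - p)) := by
    rw [← hexp, hprod]
    refine hleft.tsum_le_tsum (fun n => ?_) hsummable
    refine (mul_le_mul_of_nonneg_left (hφ.map_mul_natCast_le_sum_binomial hp0 hp1 c n)
      (by positivity)).trans_eq ?_
    rw [Finset.mul_sum]
    refine Finset.sum_congr rfl fun k hk => ?_
    have hkn : k ≤ n := Nat.lt_succ_iff.1 (Finset.mem_range.1 hk)
    rw [Nat.cast_choose ℝ hkn, mul_pow, mul_pow, ← pow_mul_pow_sub a hkn]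
    field_simp
  calc ∑' n : ℕ, (Real.exp (-a) * a ^ n / (n.factorial : ℝ)) * φ (c * p * n)
      = Real.exp (-a) * ∑' n : ℕ, a ^ n / (n.factorial : ℝ) * φ (c * p * n) := by
        rw [← tsum_mul_left]; exact tsum_congr fun n => by ring
    _ ≤ Real.exp (-a) * ((∑' n : ℕ, (a * p) ^ n / (n.factorial : ℝ) * φ (c * n)) *
          Real.exp (a * (1 - p))) := by gcongr
    _ = Real.exp (-(a * p)) * ∑' n : ℕ, (a * p) ^ n / (n.factorial : ℝ) * φ (c * n) := by
        rw [show -(a * p) = -a + a * (1 - p) by ring, Real.exp_add]; ring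
    _ = _ := by rw [← tsum_mul_left]; exact tsum_congr fun n => by ring

/-- The mean of a rescaled Poisson variable. -/
theorem tsum_poisson_mul_natCast (r c : ℝ) :
    ∑' n : ℕ, (Real.exp (-r) * r ^ n / (n.factorial : ℝ)) * (c * n) = r * c := by
  have hexp : HasSum (fun n : ℕ => r ^ n / (n.factorial : ℝ)) (Real.exp r) := by
    rw [Real.exp_eq_exp_ℝ]
    exact NormedSpace.expSeries_div_hasSum_exp r
  have hshift : HasSum (fun n : ℕ =>
      (Real.exp (-r) * r ^ (n + 1) / ((n + 1).factorial : ℝ)) * (c * (n + 1 : ℕ))) (r * c) := by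
    have hvalue : Real.exp (-r) * r * c * Real.exp r = r * c := by
      rw [Real.exp_neg]
      field_simp
    refine hvalue ▸ (hexp.mul_left (Real.exp (-r) * r * c)).congr_fun fun n => ?_
    rw [Nat.factorial_succ]
    push_cast
    field_simp
    ring
  refine HasSum.tsum_eq ?_
  rw [← hasSum_nat_add_iff' 1]
  simpa using hshift

theorem stmt_7 (s s' a : ℝ) (hs : 0 < s) (hss' : s < s') (hs'1 : s' ≤ 1) (ha : 0 < a) :
    (∀ φ : ℝ → ℝ, ConvexOn ℝ Set.univ φ →
      (∃ C : ℝ, 0 ≤ C ∧ ∀ x : ℝ, 0 ≤ x → |φ x| ≤ C * (1 + x)) →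
      ∑' n : ℕ, (Real.exp (-a) * a ^ n / (n.factorial : ℝ)) * φ (s * n) ≤
        ∑' n : ℕ, (Real.exp (-(a * s / s')) * (a * s / s') ^ n / (n.factorial : ℝ)) * φ (s' * n)) ∧
    (∑' n : ℕ, (Real.exp (-a) * a ^ n / (n.factorial : ℝ)) * (s * n) = a * s) ∧
    (∑' n : ℕ, (Real.exp (-(a * s / s')) * (a * s / s') ^ n / (n.factorial : ℝ)) * (s' * n) = a * s) := by
  have hs' : 0 < s' := hs.trans hss'
  refine ⟨?_, tsum_poisson_mul_natCast a s, ?_⟩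
  · rintro φ hφ ⟨C, hC, hbound⟩
    have h := hφ.tsum_poisson_le_tsum_poisson_thinning hC hbound ha.le hs'.le
      (div_pos hs hs').le ((div_le_one hs').2 hss'.le)
    rwa [mul_div_cancel₀ s hs'.ne', ← mul_div_assoc] at h
  · rw [tsum_poisson_mul_natCast, div_mul_cancel₀ _ hs'.ne']
end

section
/- Fix real numbers τ and η with 0 < τ < 1 and 0 ≤ η ≤ 1, and set λ = (1 − η)/τ. Then ∑_{n=0}^{∞} ∑_{m=0}^{∞} (exp(−η)·ηⁿ/n!)·(exp(−λ)·λᵐ/m!)·max(n + τ·m − 1, 0) = exp(−η) · ∑_{m=0}^{∞} (exp(−λ)·λᵐ/m!)·max(1 − τ·m, 0). -/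
theorem hasSum_poisson_mass (r : ℝ) :
    HasSum (fun n : ℕ => Real.exp (-r) * r ^ n / (n.factorial : ℝ)) 1 := by
  have h := (NormedSpace.expSeries_div_hasSum_exp r).mul_left (Real.exp (-r))
  rw [← Real.exp_eq_exp_ℝ, ← Real.exp_add, neg_add_cancel, Real.exp_zero] at h
  simpa only [mul_div_assoc] using h

theorem hasSum_poisson_mass_mul_cast (r : ℝ) :
    HasSum (fun n : ℕ => Real.exp (-r) * r ^ n / (n.factorial : ℝ) * n) r := by
  rw [← hasSum_nat_add_iff' 1]
  have h := (hasSum_poisson_mass r).mul_left r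
  simp only [Finset.range_one, Finset.sum_singleton, Nat.cast_zero, mul_zero, sub_zero]
  rw [mul_one] at h
  refine h.congr_fun fun n => ?_
  rw [Nat.factorial_succ]
  push_cast
  field_simp
  exact pow_succ' r n

theorem hasSum_poisson_mass_mul_affine (r a b : ℝ) :
    HasSum (fun n : ℕ => Real.exp (-r) * r ^ n / (n.factorial : ℝ) * (a + b * n))
      (a + b * r) := by
  have h := ((hasSum_poisson_mass r).mul_left a).add
    ((hasSum_poisson_mass_mul_cast r).mul_left b)
  rw [mul_one] at h
  exact h.congr_fun fun n => by ring

theorem summable_poisson_mass_mul_deficit {r t : ℝ} (hr : 0 ≤ r) (ht : 0 ≤ t) :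
    Summable fun m : ℕ =>
      Real.exp (-r) * r ^ m / (m.factorial : ℝ) * max (1 - t * m) 0 := by
  refine Summable.of_nonneg_of_le (fun m => by positivity) (fun m => ?_)
    (hasSum_poisson_mass r).summable
  refine mul_le_of_le_one_right (by positivity) (max_le ?_ zero_le_one)
  have : 0 ≤ t * m := by positivity
  linarith

theorem max_cast_add_sub_one (n : ℕ) {x : ℝ} (hx : 0 ≤ x) :
    max ((n : ℝ) + x - 1) 0 = ((n : ℝ) - 1 + x) + (if n = 0 then 1 else 0) * max (1 - x) 0 := by
  rcases Nat.eq_zero_or_pos n with rfl | hn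
  · rcases le_total x 1 with h | h
    · rw [max_eq_right (by simpa using h), max_eq_left (by linarith)]
      simp
    · rw [max_eq_left (by simpa using h), max_eq_right (by linarith)]
      simp
      ring
  · have : (1 : ℝ) ≤ n := by exact_mod_cast hn
    rw [max_eq_left (by linarith), if_neg hn.ne']
    ring

theorem stmt_9 (τ η : ℝ) (hτ0 : 0 < τ) (hτ1 : τ < 1) (hη0 : 0 ≤ η) (hη1 : η ≤ 1)
    (lam : ℝ) (hlam : lam = (1 - η) / τ) :
    ∑' n : ℕ, ∑' m : ℕ,
        (Real.exp (-η) * η ^ n / (n.factorial : ℝ)) *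
          ((Real.exp (-lam) * lam ^ m / (m.factorial : ℝ)) * max ((n : ℝ) + τ * m - 1) 0) =
      Real.exp (-η) *
        ∑' m : ℕ, (Real.exp (-lam) * lam ^ m / (m.factorial : ℝ)) * max (1 - τ * m) 0 := by
  have hlam0 : 0 ≤ lam := hlam ▸ div_nonneg (by linarith) hτ0.le
  have hmean : τ * lam = 1 - η := by rw [hlam]; field_simp
  have hD := (summable_poisson_mass_mul_deficit hlam0 hτ0.le).hasSum
  set D := ∑' m : ℕ, (Real.exp (-lam) * lam ^ m / (m.factorial : ℝ)) * max (1 - τ * m) 0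
  have inner (n : ℕ) : ∑' m : ℕ, (Real.exp (-η) * η ^ n / (n.factorial : ℝ)) *
      ((Real.exp (-lam) * lam ^ m / (m.factorial : ℝ)) * max ((n : ℝ) + τ * m - 1) 0) =
      Real.exp (-η) * η ^ n / (n.factorial : ℝ) * (-η + 1 * n) +
        (if n = 0 then Real.exp (-η) * D else 0) := by
    have h := ((hasSum_poisson_mass_mul_affine lam ((n : ℝ) - 1) τ).add
      (hD.mul_left (if n = 0 then 1 else 0))).mul_left
        (Real.exp (-η) * η ^ n / (n.factorial : ℝ))
    refine (h.congr_fun fun m => ?_).tsum_eq.trans ?_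
    · rw [max_cast_add_sub_one n (by positivity)]
      ring
    · rw [hmean]
      split_ifs with hn
      · subst hn
        simp
        ring
      · ring
  simp_rw [inner]
  refine ((hasSum_poisson_mass_mul_affine η (-η) 1).add
    (hasSum_ite_eq 0 (Real.exp (-η) * D))).tsum_eq.trans ?_
  ring
end

section
/- Fix real numbers τ and η with 0 < τ < 1 and 0 ≤ η ≤ 1, and set λ = (1 − η)/τ. Then ∑_{n=0}^{∞} ∑_{m=0}^{∞} (exp(−η)·ηⁿ/n!)·(exp(−λ)·λᵐ/m!)·max(n + τ·m − 1, 0) ≤ exp(−η)·(η + (1/2)·√(τ·(1 − η))). -/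
/-- The mass function of the Poisson distribution with parameter `r`. -/
noncomputable def poissonMass (r : ℝ) (m : ℕ) : ℝ :=
  Real.exp (-r) * r ^ m / (m.factorial : ℝ)

theorem poissonMass_nonneg {r : ℝ} (hr : 0 ≤ r) (m : ℕ) : 0 ≤ poissonMass r m := by
  unfold poissonMass
  positivity

theorem poissonMass_zero (r : ℝ) : poissonMass r 0 = Real.exp (-r) := by
  simp [poissonMass]

theorem succ_mul_poissonMass_succ (r : ℝ) (m : ℕ) :
    ((m + 1 : ℕ) : ℝ) * poissonMass r (m + 1) = r * poissonMass r m := by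
  have h1 : (m.factorial : ℝ) ≠ 0 := by positivity
  have h2 : (m : ℝ) + 1 ≠ 0 := by positivity
  simp only [poissonMass, Nat.factorial_succ]
  push_cast
  field_simp
  ring

/-- Transport of `HasSum` along pointwise equality of the terms and equality of the sums. -/
theorem HasSum.congr_of_eq {f g : ℕ → ℝ} {a b : ℝ} (hf : HasSum f a) (hfg : ∀ m, g m = f m)
    (hab : b = a) : HasSum g b :=
  hab ▸ hf.congr_fun hfg

theorem hasSum_poissonMass (r : ℝ) : HasSum (poissonMass r) 1 := by
  have h := (NormedSpace.expSeries_div_hasSum_exp r).mul_left (Real.exp (-r))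
  rw [← Real.exp_eq_exp_ℝ, ← Real.exp_add, neg_add_cancel, Real.exp_zero] at h
  exact h.congr_fun fun m => mul_div_assoc _ _ _

theorem hasSum_poissonMass_mean (r : ℝ) :
    HasSum (fun m : ℕ => (m : ℝ) * poissonMass r m) r := by
  rw [← hasSum_nat_add_iff' 1]
  simpa [succ_mul_poissonMass_succ, -Nat.cast_add] using
    (hasSum_poissonMass r).mul_left r

theorem hasSum_poissonMass_sq (r : ℝ) :
    HasSum (fun m : ℕ => (m : ℝ) ^ 2 * poissonMass r m) (r ^ 2 + r) := by
  rw [← hasSum_nat_add_iff' 1]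
  have h := ((hasSum_poissonMass_mean r).add (hasSum_poissonMass r)).mul_left r
  refine h.congr_of_eq (fun m => ?_) ?_
  · rw [sq, mul_assoc, succ_mul_poissonMass_succ]
    push_cast
    ring
  · simp
    ring

/-- The mean absolute deviation of a scaled Poisson variable is at most its standard deviation. -/
theorem exists_hasSum_poissonMass_abs_le {r : ℝ} (hr : 0 ≤ r) (t : ℝ) :
    ∃ a, HasSum (fun m : ℕ => poissonMass r m * |t * r - t * m|) a ∧ a ≤ √(t ^ 2 * r) := by
  have hp := hasSum_poissonMass r
  have hV : HasSum (fun m : ℕ => poissonMass r m * (t * r - t * m) ^ 2) (t ^ 2 * r) := by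
    refine HasSum.congr_of_eq (((hp.mul_left (t ^ 2 * r ^ 2)).sub
      ((hasSum_poissonMass_mean r).mul_left (2 * t ^ 2 * r))).add
      ((hasSum_poissonMass_sq r).mul_left (t ^ 2)))
      (fun m => ?_) ?_
    · ring
    · ring
  have hs : Summable fun m : ℕ => poissonMass r m * |t * r - t * m| := by
    refine Summable.of_nonneg_of_le
      (fun m => mul_nonneg (poissonMass_nonneg hr m) (abs_nonneg _)) (fun m => ?_)
      (hp.add hV).summable
    have h := poissonMass_nonneg hr m
    have hx : |t * r - t * m| ≤ 1 + (t * r - t * m) ^ 2 := by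
      nlinarith [sq_abs (t * r - t * m), sq_nonneg (|t * r - t * m| - 1)]
    calc _ ≤ poissonMass r m * (1 + (t * r - t * m) ^ 2) := by gcongr
      _ = _ := by ring
  obtain ⟨a, ha⟩ := hs
  refine ⟨a, ha, Real.le_sqrt_of_sq_le ?_⟩
  have h : HasSum (fun m : ℕ => poissonMass r m * (|t * r - t * m| - a) ^ 2)
      (t ^ 2 * r - 2 * a * a + a ^ 2 * 1) := by
    refine HasSum.congr_of_eq ((hV.sub (ha.mul_left (2 * a))).add (hp.mul_left (a ^ 2)))
      (fun m => ?_) ?_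
    · rw [← sq_abs (t * r - t * m)]
      ring
    · ring
  have := h.nonneg fun m => mul_nonneg (poissonMass_nonneg hr m) (sq_nonneg _)
  nlinarith

theorem exists_hasSum_poissonMass_shortfall_le {r t η : ℝ} (hr : 0 ≤ r) (hη : 0 ≤ η)
    (htr : t * r = 1 - η) :
    ∃ a, HasSum (fun m : ℕ => poissonMass r m * max (1 - t * m) 0) a ∧
      a ≤ η + 1 / 2 * √(t ^ 2 * r) := by
  obtain ⟨b, hb, hb_le⟩ := exists_hasSum_poissonMass_abs_le hr t
  have hp := hasSum_poissonMass r
  have hu : HasSum (fun m : ℕ => poissonMass r m *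
      ((1 - t * m) / 2 + η / 2 + |t * r - t * m| / 2)) (η + 1 / 2 * b) := by
    refine HasSum.congr_of_eq (((hp.mul_left ((1 + η) / 2)).sub
      ((hasSum_poissonMass_mean r).mul_left (t / 2))).add (hb.mul_left (1 / 2)))
      (fun m => ?_) ?_
    · ring
    · linear_combination htr / 2
  have hle (m : ℕ) : poissonMass r m * max (1 - t * m) 0 ≤
      poissonMass r m * ((1 - t * m) / 2 + η / 2 + |t * r - t * m| / 2) := by
    refine mul_le_mul_of_nonneg_left (max_le ?_ ?_) (poissonMass_nonneg hr m)
    · linarith [le_abs_self (t * r - t * m)]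
    · linarith [neg_abs_le (t * r - t * m)]
  obtain ⟨a, ha⟩ := Summable.of_nonneg_of_le
    (fun m => mul_nonneg (poissonMass_nonneg hr m) (le_max_right _ _)) hle hu.summable
  exact ⟨a, ha, (hasSum_le hle ha hu).trans (by linarith)⟩

theorem stmt_10 (τ η : ℝ) (hτ0 : 0 < τ) (hτ1 : τ < 1) (hη0 : 0 ≤ η) (hη1 : η ≤ 1)
    (lam : ℝ) (hlam : lam = (1 - η) / τ) :
    ∑' n : ℕ, ∑' m : ℕ,
        (Real.exp (-η) * η ^ n / (n.factorial : ℝ)) *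
          ((Real.exp (-lam) * lam ^ m / (m.factorial : ℝ)) * max ((n : ℝ) + τ * m - 1) 0) ≤
      Real.exp (-η) * (η + (1 / 2) * Real.sqrt (τ * (1 - η))) := by
  change ∑' n : ℕ, ∑' m : ℕ,
    poissonMass η n * (poissonMass lam m * max ((n : ℝ) + τ * m - 1) 0) ≤ _
  have hr : 0 ≤ lam := hlam ▸ div_nonneg (by linarith) hτ0.le
  have htr : τ * lam = 1 - η := by
    rw [hlam]
    field_simp
  obtain ⟨a, ha, ha_le⟩ := exists_hasSum_poissonMass_shortfall_le hr hη0 htr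
  have hinner (n : ℕ) :
      HasSum (fun m : ℕ => poissonMass η n * (poissonMass lam m * max ((n : ℝ) + τ * m - 1) 0))
        (poissonMass η n * (n - η + if n = 0 then a else 0)) := by
    refine HasSum.mul_left _ ?_
    have hY : HasSum (fun m : ℕ => poissonMass lam m * ((n : ℝ) + τ * m - 1)) (n - η) := by
      refine HasSum.congr_of_eq (((hasSum_poissonMass lam).mul_left ((n : ℝ) - 1)).add
        ((hasSum_poissonMass_mean lam).mul_left τ))
        (fun m => ?_) ?_
      · ring
      · linear_combination -1 * htr
    rcases n.eq_zero_or_pos with rfl | hn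
    · refine (hY.add ha).congr_of_eq (fun m => ?_) ?_
      · rcases le_total (τ * m) 1 with h | h
        · rw [max_eq_right (by push_cast; linarith), max_eq_left (by linarith)]
          push_cast
          ring
        · rw [max_eq_left (by push_cast; linarith), max_eq_right (by linarith)]
          ring
      · simp
    · rw [if_neg hn.ne', add_zero]
      refine hY.congr_fun fun m => ?_
      have hn1 : (1 : ℝ) ≤ n := by exact_mod_cast hn
      have : 0 ≤ τ * m := by positivity
      rw [max_eq_left (by linarith)]
  have houter : HasSum (fun n : ℕ => poissonMass η n * (n - η + if n = 0 then a else 0))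
      (Real.exp (-η) * a) := by
    refine HasSum.congr_of_eq (((hasSum_poissonMass_mean η).sub
      ((hasSum_poissonMass η).mul_left η)).add
      (hasSum_ite_eq 0 (Real.exp (-η) * a)))
      (fun n => ?_) ?_
    · split_ifs with h
      · rw [h, poissonMass_zero]
        ring
      · ring
    · ring
  rw [tsum_congr fun n => (hinner n).tsum_eq, houter.tsum_eq]
  have hvar : τ ^ 2 * lam = τ * (1 - η) := by rw [← htr]; ring
  rw [hvar] at ha_le
  gcongr
end

section
/- Fix real numbers τ > 0 and λ ≥ 0 with τ·λ ≤ 1. Then ∑_{m=0}^{∞} (exp(−λ)·λᵐ/m!)·max(1 − τ·m, 0) ≤ (1 − τ·λ) + (1/2)·τ·√λ. -/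
theorem hasSum_poisson_one (r : ℝ) :
    HasSum (fun m : ℕ ↦ Real.exp (-r) * r ^ m / (m.factorial : ℝ)) 1 := by
  have h := (NormedSpace.expSeries_div_hasSum_exp r).mul_left (Real.exp (-r))
  rw [← congrFun Real.exp_eq_exp_ℝ r, ← Real.exp_add, neg_add_cancel, Real.exp_zero] at h
  simpa only [mul_div_assoc] using h

/-- The Chen–Stein identity for Poisson weights. -/
theorem hasSum_poisson_nat_mul (r : ℝ) {f : ℕ → ℝ} {a : ℝ}
    (hf : HasSum (fun m : ℕ ↦ Real.exp (-r) * r ^ m / (m.factorial : ℝ) * f (m + 1)) a) :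
    HasSum (fun m : ℕ ↦ Real.exp (-r) * r ^ m / (m.factorial : ℝ) * (m * f m)) (r * a) := by
  rw [← hasSum_nat_add_iff' 1]
  convert hf.mul_left r using 1
  · rfl
  · funext m
    have : (m.factorial : ℝ) ≠ 0 := by positivity
    have : (m : ℝ) + 1 ≠ 0 := by positivity
    rw [Nat.factorial_succ]
    push_cast
    field_simp
    ring
  · simp

theorem hasSum_poisson_mean (r : ℝ) :
    HasSum (fun m : ℕ ↦ Real.exp (-r) * r ^ m / (m.factorial : ℝ) * m) r := by
  simpa using hasSum_poisson_nat_mul r (f := fun _ ↦ 1) (a := 1)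
    (by simpa using hasSum_poisson_one r)

theorem hasSum_poisson_sq (r : ℝ) :
    HasSum (fun m : ℕ ↦ Real.exp (-r) * r ^ m / (m.factorial : ℝ) * (m * m))
      (r * (r + 1)) := by
  refine hasSum_poisson_nat_mul r (f := fun m ↦ (m : ℝ)) ?_
  simpa [mul_add] using (hasSum_poisson_mean r).add (hasSum_poisson_one r)

theorem max_add_zero_le_add_sq {c x s : ℝ} (hc : 0 ≤ c) (hs : 0 < s) :
    max (c + x) 0 ≤ c + x / 2 + x ^ 2 / (4 * s) + s / 4 := by
  have key (y : ℝ) : y ≤ y ^ 2 / (2 * s) + s / 2 := by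
    have : y ^ 2 / (2 * s) + s / 2 - y = (y - s) ^ 2 / (2 * s) := by
      field_simp
      ring
    have : 0 ≤ (y - s) ^ 2 / (2 * s) := by positivity
    linarith
  have h₁ := key x
  have h₂ := key (-x)
  have h₃ : x ^ 2 / (4 * s) = x ^ 2 / (2 * s) / 2 := by
    field_simp
    norm_num
  rw [neg_sq] at h₂
  apply max_le <;> linarith

theorem stmt_11 (τ lam : ℝ) (hτ : 0 < τ) (hlam : 0 ≤ lam) (h : τ * lam ≤ 1) :
    ∑' m : ℕ, (Real.exp (-lam) * lam ^ m / (m.factorial : ℝ)) * max (1 - τ * m) 0 ≤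
      (1 - τ * lam) + (1 / 2) * τ * Real.sqrt lam := by
  obtain rfl | hpos := hlam.eq_or_lt
  · rw [tsum_eq_single 0 (fun m hm ↦ by simp [hm])]
    simp
  set s := τ * Real.sqrt lam with hs
  have hs₀ : 0 < s := by positivity
  have hs_sq : s ^ 2 = τ ^ 2 * lam := by rw [hs, mul_pow, Real.sq_sqrt hlam]
  have hbound (m : ℕ) :
      Real.exp (-lam) * lam ^ m / (m.factorial : ℝ) * max (1 - τ * m) 0 ≤
        Real.exp (-lam) * lam ^ m / (m.factorial : ℝ) *
          (1 - τ * lam + τ * (lam - m) / 2 + (τ * (lam - m)) ^ 2 / (4 * s) + s / 4) := by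
    have hsplit : 1 - τ * m = 1 - τ * lam + τ * (lam - m) := by ring
    rw [hsplit]
    gcongr
    exact max_add_zero_le_add_sq (sub_nonneg.2 h) hs₀
  have hsum : HasSum (fun m : ℕ ↦ Real.exp (-lam) * lam ^ m / (m.factorial : ℝ) *
      (1 - τ * lam + τ * (lam - m) / 2 + (τ * (lam - m)) ^ 2 / (4 * s) + s / 4))
      (1 - τ * lam + s / 2) := by
    convert (((hasSum_poisson_one lam).mul_right
        (1 - τ * lam + τ * lam / 2 + (τ * lam) ^ 2 / (4 * s) + s / 4)).add
      ((hasSum_poisson_mean lam).mul_right (-τ / 2 - 2 * τ ^ 2 * lam / (4 * s)))).add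
      ((hasSum_poisson_sq lam).mul_right (τ ^ 2 / (4 * s))) using 1
    · rfl
    · funext m
      ring
    · have hvar : τ ^ 2 * lam / (4 * s) = s / 4 := by
        rw [← hs_sq]
        field_simp
      linear_combination -hvar
  have hsummable := Summable.of_nonneg_of_le (fun m ↦ by positivity) hbound hsum.summable
  calc
    _ ≤ 1 - τ * lam + s / 2 := hasSum_le hbound hsummable.hasSum hsum
    _ = _ := by
      rw [hs]
      ring
end

section
/- Fix a real number τ with 0 < τ ≤ 1. The function B₂ : ℝ → ℝ defined by B₂(x) = exp(−x)·(x + (√τ/2)·√(1 − x)) is concave on the interval [0, 1]. -/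
theorem hasDerivAt_sqrt_one_sub {x : ℝ} (hx : x < 1) :
    HasDerivAt (fun y : ℝ => Real.sqrt (1 - y)) (-1 / (2 * Real.sqrt (1 - x))) x :=
  ((hasDerivAt_id x).const_sub 1).sqrt (sub_pos.mpr hx).ne'

theorem mul_quartic_le {c s : ℝ} (hc0 : 0 ≤ c) (hc : c ≤ 1 / 2) (hs0 : 0 ≤ s) (hs1 : s ≤ 1) :
    c * (4 * s ^ 4 + 4 * s ^ 2 - 1) ≤ 4 * s ^ 3 + 4 * s ^ 5 := by
  have h4 : s ^ 4 ≤ s ^ 3 := pow_le_pow_of_le_one hs0 hs1 (by norm_num)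
  have h2 : 4 * s ^ 2 - 1 ≤ 4 * s ^ 3 := by
    nlinarith [mul_nonneg hs0 (sq_nonneg (s - 2 / 3)), sq_nonneg (s - 2 / 3)]
  have h5 : 0 ≤ s ^ 5 := by positivity
  have h3 : 0 ≤ s ^ 3 := by positivity
  calc c * (4 * s ^ 4 + 4 * s ^ 2 - 1) ≤ c * (8 * s ^ 3) := by gcongr; linarith
    _ ≤ 1 / 2 * (8 * s ^ 3) := by gcongr
    _ ≤ 4 * s ^ 3 + 4 * s ^ 5 := by linarith

theorem concaveOn_exp_neg_mul_add_sqrt {c : ℝ} (hc0 : 0 ≤ c) (hc : c ≤ 1 / 2) :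
    ConcaveOn ℝ (Set.Icc (0 : ℝ) 1)
      (fun x : ℝ => Real.exp (-x) * (x + c * Real.sqrt (1 - x))) := by
  have hexp (x : ℝ) : HasDerivAt (fun y : ℝ => Real.exp (-y)) (-Real.exp (-x)) x := by
    simpa using (hasDerivAt_neg x).exp
  refine concaveOn_of_hasDerivWithinAt2_nonpos (convex_Icc 0 1)
    (f' := fun x => Real.exp (-x) *
      (1 - x - c * Real.sqrt (1 - x) - c / 2 * (Real.sqrt (1 - x))⁻¹))
    (f'' := fun x => Real.exp (-x) *
      (x - 2 + c * Real.sqrt (1 - x) + c / Real.sqrt (1 - x) - c / (4 * Real.sqrt (1 - x) ^ 3)))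
    (by fun_prop) ?_ ?_ ?_ <;> rw [interior_Icc] <;> rintro x ⟨hx0, hx1⟩ <;>
    have hs : 0 < Real.sqrt (1 - x) := Real.sqrt_pos.mpr (sub_pos.mpr hx1)
  · refine HasDerivAt.hasDerivWithinAt ?_
    refine ((hexp x).mul ((hasDerivAt_id x).add
      ((hasDerivAt_sqrt_one_sub hx1).const_mul c))).congr_deriv ?_
    simp only [id, Pi.add_apply]
    field_simp
    ring
  · refine HasDerivAt.hasDerivWithinAt ?_
    have hsqrt := hasDerivAt_sqrt_one_sub hx1
    refine ((hexp x).mul ((((hasDerivAt_id x).const_sub 1).sub (hsqrt.const_mul c)).sub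
      ((hsqrt.inv hs.ne').const_mul (c / 2)))).congr_deriv ?_
    simp only [id, Pi.sub_apply, Pi.inv_apply]
    field_simp
    ring
  · have hs1 : Real.sqrt (1 - x) ≤ 1 := Real.sqrt_le_one.mpr (by linarith)
    have hsq : x = 1 - Real.sqrt (1 - x) ^ 2 := by rw [Real.sq_sqrt (by linarith)]; ring
    refine mul_nonpos_of_nonneg_of_nonpos (Real.exp_pos _).le ?_
    generalize Real.sqrt (1 - x) = s at hs hs1 hsq
    have key : x - 2 + c * s + c / s - c / (4 * s ^ 3)
        = (c * (4 * s ^ 4 + 4 * s ^ 2 - 1) - (4 * s ^ 3 + 4 * s ^ 5)) / (4 * s ^ 3) := by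
      rw [hsq]
      field_simp
      ring
    rw [key]
    exact div_nonpos_of_nonpos_of_nonneg
      (sub_nonpos.mpr (mul_quartic_le hc0 hc hs.le hs1)) (by positivity)

theorem stmt_13 (τ : ℝ) (hτ0 : 0 < τ) (hτ1 : τ ≤ 1) :
    ConcaveOn ℝ (Set.Icc (0 : ℝ) 1)
      (fun x : ℝ => Real.exp (-x) * (x + (Real.sqrt τ / 2) * Real.sqrt (1 - x))) := by
  have h : Real.sqrt τ ≤ 1 := Real.sqrt_le_one.mpr hτ1
  exact concaveOn_exp_neg_mul_add_sqrt (by positivity) (by linarith)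
end

section
/- Let V be a finite set of resources, T a finite set of types, n ≥ 1 a natural number, p : T → ℝ with p_j ≥ 0, and Γ : T → Finset V a compatibility map. Call x : V × T → ℝ feasible if x_{ij} ≥ 0 for all i, j, x_{ij} = 0 whenever v_i ∉ Γ(t_j), ∑_{j : v_i ∈ Γ(t_j)} n·p_j·x_{ij} ≤ 1 for every v_i ∈ V, and ∑_{v_i ∈ Γ(t_j)} x_{ij} ≤ 1 for every t_j ∈ T; write Z(x) = ∑_j n·p_j·∑_{v_i ∈ Γ(t_j)} x_{ij}. Let C ⊆ V be a nonempty equivalence class of interchangeable resources, i.e. for every t_j ∈ T and every v, v′ ∈ C, v ∈ Γ(t_j) if and only if v′ ∈ Γ(t_j), and let ℓ = |C|. Then for every feasible x there exists a feasible x* with Z(x*) = Z(x) and x*_{ij} ≤ 1/ℓ for every v_i ∈ C and every t_j ∈ T. -/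
open Finset in
/-- Feasibility for the Expected Instance LP: nonnegativity, support restricted to
compatible edges, resource-capacity constraints and type-matching constraints. -/
def LPFeasible {V T : Type*} [Fintype V] [Fintype T] [DecidableEq V]
    (n : ℕ) (p : T → ℝ) (Γ : T → Finset V) (x : V → T → ℝ) : Prop :=
  (∀ i j, 0 ≤ x i j) ∧
  (∀ i j, i ∉ Γ j → x i j = 0) ∧
  (∀ i : V, ∑ j : T, (if i ∈ Γ j then (n : ℝ) * p j * x i j else 0) ≤ 1) ∧
  (∀ j : T, ∑ i ∈ Γ j, x i j ≤ 1)

open Finset in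
/-- The objective value of the Expected Instance LP. -/
def LPValue {V T : Type*} [Fintype V] [Fintype T]
    (n : ℕ) (p : T → ℝ) (Γ : T → Finset V) (x : V → T → ℝ) : ℝ :=
  ∑ j : T, (n : ℝ) * p j * ∑ i ∈ Γ j, x i j

/-- The function obtained from `f` by replacing its values on `C` by their average over `C`. -/
noncomputable def averageOn {V : Type*} [DecidableEq V] (C : Finset V) (f : V → ℝ) (i : V) : ℝ :=
  if i ∈ C then (∑ v ∈ C, f v) / C.card else f i

section averageOn

variable {V : Type*} [DecidableEq V] {C : Finset V} {f : V → ℝ} {i : V}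

theorem averageOn_of_mem (hi : i ∈ C) : averageOn C f i = (∑ v ∈ C, f v) / C.card := if_pos hi

theorem averageOn_of_notMem (hi : i ∉ C) : averageOn C f i = f i := if_neg hi

theorem averageOn_nonneg (hf : ∀ v, 0 ≤ f v) (i : V) : 0 ≤ averageOn C f i := by
  unfold averageOn
  split_ifs
  · exact div_nonneg (Finset.sum_nonneg fun v _ => hf v) (Nat.cast_nonneg _)
  · exact hf i

theorem sum_averageOn (C : Finset V) (f : V → ℝ) :
    ∑ v ∈ C, averageOn C f v = ∑ v ∈ C, f v := by
  rcases C.eq_empty_or_nonempty with rfl | hC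
  · simp
  have hcard : (C.card : ℝ) ≠ 0 := by exact_mod_cast hC.card_pos.ne'
  rw [Finset.sum_congr rfl fun v hv => averageOn_of_mem hv, Finset.sum_const, nsmul_eq_mul,
    mul_div_cancel₀ _ hcard]

theorem sum_univ_averageOn [Fintype V] (C : Finset V) (f : V → ℝ) :
    ∑ v, averageOn C f v = ∑ v, f v := by
  rw [← Finset.sum_add_sum_compl C, ← Finset.sum_add_sum_compl C f, sum_averageOn]
  congr 1
  exact Finset.sum_congr rfl fun v hv => averageOn_of_notMem (Finset.mem_compl.mp hv)

/-- Averaging over `C` preserves vanishing outside a set that contains all or none of `C`. -/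
theorem averageOn_eq_zero {S : Finset V} (hS : ∀ v ∈ C, ∀ v' ∈ C, (v ∈ S ↔ v' ∈ S))
    (hf : ∀ v, v ∉ S → f v = 0) (hi : i ∉ S) : averageOn C f i = 0 := by
  by_cases hiC : i ∈ C
  · rw [averageOn_of_mem hiC,
      Finset.sum_eq_zero fun v hv => hf v fun hvS => hi ((hS v hv i hiC).mp hvS), zero_div]
  · rw [averageOn_of_notMem hiC, hf i hi]

end averageOn

open Finset in
theorem stmt_16 {V T : Type*} [Fintype V] [Fintype T] [DecidableEq V]
    (n : ℕ) (hn : 1 ≤ n) (p : T → ℝ) (hp : ∀ j, 0 ≤ p j) (Γ : T → Finset V)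
    (C : Finset V) (hC : C.Nonempty)
    (hinter : ∀ j : T, ∀ v ∈ C, ∀ v' ∈ C, (v ∈ Γ j ↔ v' ∈ Γ j))
    (x : V → T → ℝ) (hx : LPFeasible n p Γ x) :
    ∃ xstar : V → T → ℝ, LPFeasible n p Γ xstar ∧
      LPValue n p Γ xstar = LPValue n p Γ x ∧
      ∀ i ∈ C, ∀ j : T, xstar i j ≤ 1 / (C.card : ℝ) := by
  obtain ⟨hnonneg, hsupp, hcap, hmatch⟩ := hx
  have hcard : (0 : ℝ) < C.card := by exact_mod_cast hC.card_pos
  have hsupp' : ∀ i j, i ∉ Γ j → averageOn C (x · j) i = 0 := fun i j hi =>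
    averageOn_eq_zero (hinter j) (fun v => hsupp v j) hi
  have hrow : ∀ j, ∑ i ∈ Γ j, x i j = ∑ i, x i j := fun j =>
    sum_subset (subset_univ _) fun i _ hi => hsupp i j hi
  have hsum : ∀ j, ∑ i ∈ Γ j, averageOn C (x · j) i = ∑ i ∈ Γ j, x i j := fun j => by
    rw [hrow, ← sum_univ_averageOn C]
    exact sum_subset (subset_univ _) fun i _ hi => hsupp' i j hi
  have hload : ∀ y : V → T → ℝ, (∀ i j, i ∉ Γ j → y i j = 0) → ∀ i,
      ∑ j, (if i ∈ Γ j then (n : ℝ) * p j * y i j else 0) = ∑ j, (n : ℝ) * p j * y i j := by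
    intro y hy i
    refine sum_congr rfl fun j _ => ?_
    split_ifs with h
    · rfl
    · rw [hy i j h, mul_zero]
  have hcap' : ∀ i, ∑ j, (n : ℝ) * p j * x i j ≤ 1 := fun i => hload x hsupp i ▸ hcap i
  refine ⟨fun i j => averageOn C (x · j) i,
    ⟨fun i j => averageOn_nonneg (fun v => hnonneg v j) i, hsupp', fun i => ?_,
      fun j => (hsum j).trans_le (hmatch j)⟩,
    by simp only [LPValue, hsum], fun i hi j => ?_⟩
  · rw [hload _ hsupp']
    by_cases hi : i ∈ C
    · simp only [averageOn_of_mem hi, ← mul_div_assoc, mul_sum]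
      rw [← sum_div, sum_comm, div_le_one hcard]
      simpa using sum_le_sum fun v (_ : v ∈ C) => hcap' v
    · simpa only [averageOn_of_notMem hi] using hcap' i
  · simp only [averageOn_of_mem hi]
    gcongr
    calc ∑ v ∈ C, x v j ≤ ∑ v, x v j :=
          sum_le_sum_of_subset_of_nonneg (subset_univ _) fun v _ _ => hnonneg v j
      _ ≤ 1 := hrow j ▸ hmatch j
end
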